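/- Let 0 < α_s < P_s, β_s = P_s − α_s, and R > 0, and set β1 = √((2^R − 1)/P_s) and η1 = √((2^R − 1)/β_s). Then for every g with 0 ≤ g ≤ β1, ζ1(g) := (−g·√α_s + √(g²·(α_s − P_s) + 2^R − 1))/√P_s satisfies ζ1(g) < η1. -/

import Mathlib

/-- for `0 < α_s < P_s`, `β_s = P_s - α_s`, target rate `R > 0`,
`β1 = √((2^R - 1)/P_s)` and `η1 = √((2^R - 1)/β_s)`, the threshold
`ζ1(g) = (-g √α_s + √(g² (α_s - P_s) + 2^R - 1))/√P_s` satisfies `ζ1(g) < η1` for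
all `0 ≤ g ≤ β1`. -/
theorem zeta_lt_eta (Ps αs R : ℝ) (hαs : 0 < αs) (hαsP : αs < Ps) (hR : 0 < R)
    (βs β1 η1 : ℝ)
    (hβs : βs = Ps - αs)
    (hβ1 : β1 = Real.sqrt (((2 : ℝ) ^ R - 1) / Ps))
    (hη1 : η1 = Real.sqrt (((2 : ℝ) ^ R - 1) / βs)) :
    ∀ g : ℝ, 0 ≤ g → g ≤ β1 →
      (-(g * Real.sqrt αs)
        + Real.sqrt (g ^ 2 * (αs - Ps) + (2 : ℝ) ^ R - 1)) / Real.sqrt Ps < η1 := by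
  intro g hg _
  subst hβs hη1
  have hPs : 0 < Ps := hαs.trans hαsP
  have hβ : 0 < Ps - αs := sub_pos.mpr hαsP
  have hc : 0 < (2 : ℝ) ^ R - 1 := sub_pos.mpr (Real.one_lt_rpow one_lt_two hR)
  calc (-(g * Real.sqrt αs)
        + Real.sqrt (g ^ 2 * (αs - Ps) + (2 : ℝ) ^ R - 1)) / Real.sqrt Ps
      ≤ Real.sqrt ((2 : ℝ) ^ R - 1) / Real.sqrt Ps := by
        have h₁ : 0 ≤ g * Real.sqrt αs := by positivity
        have h₂ : Real.sqrt (g ^ 2 * (αs - Ps) + (2 : ℝ) ^ R - 1)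
            ≤ Real.sqrt ((2 : ℝ) ^ R - 1) :=
          Real.sqrt_le_sqrt (by nlinarith [mul_nonneg (sq_nonneg g) hβ.le])
        gcongr
        linarith
    _ = Real.sqrt (((2 : ℝ) ^ R - 1) / Ps) := (Real.sqrt_div hc.le Ps).symm
    _ < Real.sqrt (((2 : ℝ) ^ R - 1) / (Ps - αs)) :=
        Real.sqrt_lt_sqrt (by positivity)
          (div_lt_div_of_pos_left hc hβ (sub_lt_self Ps hαs))
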